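/- If Ξ₁ and Ξ₂ are both self-dual 3-forms on V, or both antiself-dual 3-forms on V, then their Clifford product vanishes: Ξ₁ Ξ₂ = 0 in Cℓ(V) (acting on Σ). -/

import Mathlib

/-!
Algebraic set-up for six-dimensional (1,0) spinor calculus.

`(V, η)` is the six-dimensional mostly-plus lorentzian vector space, realised as
`Fin 6 → ℝ` with metric `ηd = diag(-1,1,1,1,1,1)`.  The (complexified) Clifford
module `Σ` is realised as `Spinor8 = Fin 8 → ℂ`; the structure `CliffordData`
packages gamma matrices satisfying the Clifford relation `v·v = η(v,v)𝟙`, the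
symmetric spinor inner product `⟨-,-⟩` (given by the matrix `B`, symmetric,
nondegenerate, with `⟨v·s,t⟩ = -⟨s,v·t⟩`, and for which the chiral summands are
isotropic), and the quaternionic structure `J`.  `Δ` is the fundamental `Sp(1)`
module `Fin 2 → ℂ` with symplectic form `epsS` (`ε₁₂ = 1`), and an element of
the real representation `S` with `S ⊗ ℂ = Σ₊ ⊗ Δ` is a pair `s : Fin 2 → Spinor8`
of positive-chirality spinors satisfying the reality condition `IsS`.
-/

noncomputable section

open Matrix BigOperators

/-- Spinors of the 8-dimensional complex Clifford module Σ. -/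
abbrev Spinor8 := Fin 8 → ℂ

/-- Mostly-plus Minkowski metric `diag(-1,1,1,1,1,1)`. -/
def ηd (μ : Fin 6) : ℝ := if μ = 0 then -1 else 1

/-- The symplectic form ε on Δ, with `ε₁₂ = 1`. -/
def epsS (A B : Fin 2) : ℂ := if A = 0 ∧ B = 1 then 1 else if A = 1 ∧ B = 0 then -1 else 0

/-- The Levi-Civita symbol on six indices. -/
def eps6 (μ ν ρ σ τ υ : Fin 6) : ℝ :=
  (Matrix.of (fun i j => if (![μ, ν, ρ, σ, τ, υ] i) = j then (1 : ℝ) else 0) :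
    Matrix (Fin 6) (Fin 6) ℝ).det

/-- Data of the irreducible Clifford module Σ of `Cℓ(V)`, `V = ℝ^{5,1}`:
gamma matrices, the symmetric spinor pairing `B` and the quaternionic
structure `J`. -/
structure CliffordData where
  /-- gamma matrices `Γ_μ` -/
  Γ : Fin 6 → Matrix (Fin 8) (Fin 8) ℂ
  /-- the Clifford relation `Γ_μ Γ_ν + Γ_ν Γ_μ = 2 η_{μν} 𝟙` -/
  clifford : ∀ μ ν, Γ μ * Γ ν + Γ ν * Γ μ =
    (if μ = ν then 2 * (ηd μ : ℂ) else 0) • (1 : Matrix (Fin 8) (Fin 8) ℂ)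
  /-- matrix of the symmetric inner product `⟨-,-⟩`, `⟨s,t⟩ = sᵀ B t` -/
  B : Matrix (Fin 8) (Fin 8) ℂ
  B_symm : B.transpose = B
  B_nondeg : IsUnit B
  /-- `⟨v·s, t⟩ = -⟨s, v·t⟩` -/
  B_skew : ∀ μ, (Γ μ).transpose * B = - (B * Γ μ)
  /-- the chiral summands `Σ±` are isotropic for `⟨-,-⟩`:
      `⟨P₊s, P₊t⟩ = 0 = ⟨P₋s, P₋t⟩`, where `P± = ½(1 ± Γ₇)` -/
  B_iso_pos : ((1 : Matrix (Fin 8) (Fin 8) ℂ) + Γ 0 * Γ 1 * Γ 2 * Γ 3 * Γ 4 * Γ 5).transpose *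
      B * (1 + Γ 0 * Γ 1 * Γ 2 * Γ 3 * Γ 4 * Γ 5) = 0
  B_iso_neg : ((1 : Matrix (Fin 8) (Fin 8) ℂ) - Γ 0 * Γ 1 * Γ 2 * Γ 3 * Γ 4 * Γ 5).transpose *
      B * (1 - Γ 0 * Γ 1 * Γ 2 * Γ 3 * Γ 4 * Γ 5) = 0
  /-- quaternionic structure on Σ: the conjugate-linear map `s ↦ J (star s)` -/
  J : Matrix (Fin 8) (Fin 8) ℂ
  J_conj : ∀ μ, J * (Γ μ).map (starRingEnd ℂ) = Γ μ * J
  J_sq : J * J.map (starRingEnd ℂ) = -1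

namespace CliffordData

variable (d : CliffordData)

/-- the Clifford volume element `Γ₇ = Γ₀Γ₁Γ₂Γ₃Γ₄Γ₅` -/
def Γ7 : Matrix (Fin 8) (Fin 8) ℂ := d.Γ 0 * d.Γ 1 * d.Γ 2 * d.Γ 3 * d.Γ 4 * d.Γ 5

/-- gamma matrix with raised index, `Γ^μ = η^{μμ} Γ_μ` -/
def ΓU (μ : Fin 6) : Matrix (Fin 8) (Fin 8) ℂ := (ηd μ : ℂ) • d.Γ μ

/-- the pairing `s̄ t = ⟨s, t⟩` -/
def pair (s t : Spinor8) : ℂ := s ⬝ᵥ d.B.mulVec t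

/-- positive chirality: `Γ₇ s = s`, i.e. `s ∈ Σ₊` -/
def Pos (s : Spinor8) : Prop := d.Γ7.mulVec s = s

/-- the quaternionic conjugation on Σ -/
def conjS (s : Spinor8) : Spinor8 := d.J.mulVec fun a => (starRingEnd ℂ) (s a)

/-- membership in (the complexification of) the real form `S ⊂ Σ₊ ⊗ Δ`:
positive chirality together with the reality condition w.r.t. the
quaternionic structure `J ⊗ J_Δ` (`J_Δ` the standard one on `Δ`). -/
def IsS (s : Fin 2 → Spinor8) : Prop :=
  (∀ A, d.Pos (s A)) ∧ d.conjS (s 0) = s 1 ∧ d.conjS (s 1) = - s 0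

/-- antisymmetrised product `Γ_{μν}` -/
def Γ2 (μ ν : Fin 6) : Matrix (Fin 8) (Fin 8) ℂ :=
  (1 / 2 : ℂ) • (d.Γ μ * d.Γ ν - d.Γ ν * d.Γ μ)

/-- antisymmetrised product `Γ_{μνρ}` -/
def Γ3 (μ ν ρ : Fin 6) : Matrix (Fin 8) (Fin 8) ℂ :=
  (1 / 6 : ℂ) • (d.Γ μ * d.Γ ν * d.Γ ρ - d.Γ μ * d.Γ ρ * d.Γ ν
    + d.Γ ν * d.Γ ρ * d.Γ μ - d.Γ ν * d.Γ μ * d.Γ ρ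
    + d.Γ ρ * d.Γ μ * d.Γ ν - d.Γ ρ * d.Γ ν * d.Γ μ)

/-- the family of 3-forms `ω_{μνρ}{}^{AB} = s̄^A Γ_{μνρ} s^B` -/
def omega3 (s : Fin 2 → Spinor8) (A B : Fin 2) (μ ν ρ : Fin 6) : ℂ :=
  d.pair (s A) ((d.Γ3 μ ν ρ).mulVec (s B))

/-- the Dirac current `κ^μ = ε_{AB} s̄^A Γ^μ s^B` -/
def kappa (s : Fin 2 → Spinor8) (μ : Fin 6) : ℂ :=
  ∑ A, ∑ B, epsS A B * d.pair (s A) ((d.ΓU μ).mulVec (s B))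

end CliffordData

/-- Hodge star on 3-forms (components, indices down):
`(⋆T)_{μνρ} = (1/3!) ε_{μνρ}{}^{στυ} T_{στυ}`. -/
def hodge3C (T : Fin 6 → Fin 6 → Fin 6 → ℂ) (μ ν ρ : Fin 6) : ℂ :=
  (1 / 6 : ℂ) * ∑ σ, ∑ τ, ∑ υ,
    (eps6 μ ν ρ σ τ υ : ℂ) * (ηd σ : ℂ) * (ηd τ : ℂ) * (ηd υ : ℂ) * T σ τ υ

/-- (components of) an alternating 3-tensor -/
def Alt3 (T : Fin 6 → Fin 6 → Fin 6 → ℂ) : Prop :=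
  ∀ μ ν ρ, T ν μ ρ = - T μ ν ρ ∧ T μ ρ ν = - T μ ν ρ

/-- self-dual 3-form, `⋆T = T` -/
def SelfDual3 (T : Fin 6 → Fin 6 → Fin 6 → ℂ) : Prop :=
  ∀ μ ν ρ, hodge3C T μ ν ρ = T μ ν ρ

/-- antiself-dual 3-form, `⋆T = -T` -/
def AntiSelfDual3 (T : Fin 6 → Fin 6 → Fin 6 → ℂ) : Prop :=
  ∀ μ ν ρ, hodge3C T μ ν ρ = - T μ ν ρ

/-- The Clifford action `(1/3!) Ξ_{μνρ} Γ^{μνρ}` of a 3-form `Ξ` (given by its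
components) on the Clifford module Σ. -/
def cliffAct3 (d : CliffordData) (T : Fin 6 → Fin 6 → Fin 6 → ℂ) :
    Matrix (Fin 8) (Fin 8) ℂ :=
  (1 / 6 : ℂ) • ∑ μ, ∑ ν, ∑ ρ,
    (T μ ν ρ * (ηd μ : ℂ) * (ηd ν : ℂ) * (ηd ρ : ℂ)) • d.Γ3 μ ν ρ

lemma ηd_mul_self (μ : Fin 6) : (ηd μ : ℂ) * (ηd μ : ℂ) = 1 := by
  unfold ηd; split_ifs <;> simp

lemma eps6_eq_zero {μ ν ρ σ τ υ : Fin 6}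
    (h : ¬ Function.Injective ![μ, ν, ρ, σ, τ, υ]) : eps6 μ ν ρ σ τ υ = 0 := by
  rw [Function.not_injective_iff] at h
  obtain ⟨i, j, hij, hne⟩ := h
  refine Matrix.det_zero_of_row_eq hne ?_
  ext k
  simp only [Matrix.of_apply, hij]

/-- The Levi-Civita symbol of a permutation is its sign. -/
lemma eps6_perm (π : Equiv.Perm (Fin 6)) :
    eps6 (π 0) (π 1) (π 2) (π 3) (π 4) (π 5) = ((Equiv.Perm.sign π : ℤ) : ℝ) := by
  have h : ![π 0, π 1, π 2, π 3, π 4, π 5] = π := by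
    ext i; fin_cases i <;> rfl
  rw [eps6, h, ← Matrix.det_permutation]
  congr 1
  ext i j
  simp [PEquiv.toMatrix_apply, eq_comm]

lemma prod_ηd_perm (π : Equiv.Perm (Fin 6)) :
    (ηd (π 0) : ℂ) * ηd (π 1) * ηd (π 2) * ηd (π 3) * ηd (π 4) * ηd (π 5) = -1 := by
  have h := Equiv.prod_comp π fun i => (ηd i : ℂ)
  simp only [Fin.prod_univ_six] at h
  rw [h]
  simp [ηd]

/-- Three distinct indices out of six have `3!` complementary orderings. -/
lemma card_complementary_triples : ∀ σ τ υ : Fin 6, σ ≠ τ → σ ≠ υ → τ ≠ υ →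
    (∑ μ : Fin 6, if μ = σ ∨ μ = τ ∨ μ = υ then 0 else
      ∑ ν : Fin 6, if ν = μ ∨ ν = σ ∨ ν = τ ∨ ν = υ then 0 else
        ∑ ρ : Fin 6, if ρ = μ ∨ ρ = ν ∨ ρ = σ ∨ ρ = τ ∨ ρ = υ then 0 else 1) = 6 := by
  decide +kernel

lemma injective_six_iff (μ ν ρ σ τ υ : Fin 6) :
    Function.Injective ![μ, ν, ρ, σ, τ, υ] ↔
      ¬ (μ = σ ∨ μ = τ ∨ μ = υ) ∧ ¬ (ν = μ ∨ ν = σ ∨ ν = τ ∨ ν = υ) ∧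
      ¬ (ρ = μ ∨ ρ = ν ∨ ρ = σ ∨ ρ = τ ∨ ρ = υ) ∧ σ ≠ τ ∧ σ ≠ υ ∧ τ ≠ υ := by
  rw [← List.nodup_ofFn]
  simp [List.ofFn_succ, Fin.succ]
  grind

open Classical in
lemma sum_injective_six {σ τ υ : Fin 6} (hστ : σ ≠ τ) (hσυ : σ ≠ υ) (hτυ : τ ≠ υ) :
    (∑ μ, ∑ ν, ∑ ρ, if Function.Injective ![μ, ν, ρ, σ, τ, υ] then (1 : ℂ) else 0) = 6 := by
  have h := congrArg (Nat.cast (R := ℂ)) (card_complementary_triples σ τ υ hστ hσυ hτυ)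
  push_cast at h
  rw [← h]
  refine Finset.sum_congr rfl fun μ _ => ?_
  by_cases hμ : μ = σ ∨ μ = τ ∨ μ = υ
  · simp [injective_six_iff, hμ]
  rw [if_neg hμ]
  refine Finset.sum_congr rfl fun ν _ => ?_
  by_cases hν : ν = μ ∨ ν = σ ∨ ν = τ ∨ ν = υ
  · simp [injective_six_iff, hν]
  rw [if_neg hν]
  refine Finset.sum_congr rfl fun ρ _ => ?_
  simp only [injective_six_iff, hμ, hν, hστ, hσυ, hτυ, ne_eq, not_false_eq_true, true_and,
    and_true, ite_not]

namespace CliffordData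

variable (d : CliffordData)

lemma Γ_anticomm {μ ν : Fin 6} (h : μ ≠ ν) : d.Γ μ * d.Γ ν = -(d.Γ ν * d.Γ μ) := by
  have := d.clifford μ ν
  rw [if_neg h, zero_smul] at this
  exact eq_neg_of_add_eq_zero_left this

lemma Γ_mul_self (μ : Fin 6) : d.Γ μ * d.Γ μ = (ηd μ : ℂ) • 1 := by
  have h := d.clifford μ μ
  rw [if_pos rfl, ← two_smul ℂ, mul_smul] at h
  exact smul_right_injective _ (two_ne_zero' ℂ) h

/-- The ordered product of the gamma matrices along a permutation is its sign times `Γ₇`. -/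
lemma prod_Γ_perm (π : Equiv.Perm (Fin 6)) :
    d.Γ (π 0) * d.Γ (π 1) * d.Γ (π 2) * d.Γ (π 3) * d.Γ (π 4) * d.Γ (π 5) =
      ((Equiv.Perm.sign π : ℤ) : ℂ) • d.Γ7 := by
  have hπ : π ∈ Submonoid.closure
      (Set.range fun i : Fin 5 ↦ Equiv.swap i.castSucc i.succ) := by
    rw [Equiv.Perm.mclosure_swap_castSucc_succ]; trivial
  induction hπ using Submonoid.closure_induction_right with
  | one => simp [Γ7]
  | mul_right π _ s hs ih =>
    obtain ⟨i, rfl⟩ := hs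
    have hsign : Equiv.Perm.sign (π * Equiv.swap i.castSucc i.succ) = - Equiv.Perm.sign π := by
      rw [Equiv.Perm.sign_mul, Equiv.Perm.sign_swap (Fin.castSucc_lt_succ).ne, mul_neg_one]
    have hswap := d.Γ_anticomm (π.injective.ne (Fin.castSucc_lt_succ (i := i)).ne')
    rw [hsign]
    push_cast
    rw [neg_smul, ← ih]
    fin_cases i <;>
      simp only [Fin.reduceFinMk, Fin.reduceCastSucc, Fin.reduceSucc] at hswap <;>
      simp [Equiv.swap_apply_def, hswap, mul_assoc]

lemma Γ_mul_Γ7 (μ : Fin 6) : d.Γ μ * d.Γ7 = -(d.Γ7 * d.Γ μ) := by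
  have hmul {a b c : Matrix (Fin 8) (Fin 8) ℂ} {s t : ℂ} (hb : a * b = s • (b * a))
      (hc : a * c = t • (c * a)) : a * (b * c) = (s * t) • (b * c * a) := by
    rw [← mul_assoc, hb, smul_mul_assoc, mul_assoc b a c, hc, mul_smul_comm, smul_smul, mul_assoc]
  have h (i : Fin 6) : d.Γ μ * d.Γ i = (if μ = i then (1 : ℂ) else -1) • (d.Γ i * d.Γ μ) := by
    split_ifs with hi
    · rw [hi, one_smul]
    · rw [neg_one_smul, d.Γ_anticomm hi]
  rw [Γ7, hmul (hmul (hmul (hmul (hmul (h 0) (h 1)) (h 2)) (h 3)) (h 4)) (h 5), ← neg_one_smul ℂ]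
  fin_cases μ <;> simp

lemma Γ3_mul_Γ7 (μ ν ρ : Fin 6) : d.Γ3 μ ν ρ * d.Γ7 = -(d.Γ7 * d.Γ3 μ ν ρ) := by
  have h (μ ν ρ : Fin 6) :
      d.Γ μ * d.Γ ν * d.Γ ρ * d.Γ7 = -(d.Γ7 * (d.Γ μ * d.Γ ν * d.Γ ρ)) := by
    rw [mul_assoc, Γ_mul_Γ7, mul_neg, ← mul_assoc, mul_assoc (d.Γ μ), Γ_mul_Γ7, mul_neg,
      ← mul_assoc, Γ_mul_Γ7]
    simp [mul_assoc]
  simp only [Γ3, smul_mul_assoc, mul_smul_comm, add_mul, sub_mul, mul_add, mul_sub, h]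
  module

lemma Γ3_of_ne {μ ν ρ : Fin 6} (hμν : μ ≠ ν) (hμρ : μ ≠ ρ) (hνρ : ν ≠ ρ) :
    d.Γ3 μ ν ρ = d.Γ μ * d.Γ ν * d.Γ ρ := by
  rw [Γ3, mul_assoc (d.Γ μ) (d.Γ ρ), mul_assoc (d.Γ ν) (d.Γ ρ), mul_assoc (d.Γ ρ) (d.Γ ν),
    d.Γ_anticomm hνρ.symm, d.Γ_anticomm hμρ.symm, d.Γ_anticomm hμν.symm]
  simp only [mul_neg, neg_mul, ← mul_assoc, d.Γ_anticomm hμρ.symm, d.Γ_anticomm hμν.symm]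
  simp only [mul_neg, mul_assoc, d.Γ_anticomm hνρ.symm]
  module

lemma Γ3_eq_zero {μ ν ρ : Fin 6} (h : ¬ (μ ≠ ν ∧ μ ≠ ρ ∧ ν ≠ ρ)) : d.Γ3 μ ν ρ = 0 := by
  have h : μ = ν ∨ μ = ρ ∨ ν = ρ := by tauto
  rw [Γ3]
  rcases h with rfl | rfl | rfl <;> module

lemma prod_three_sq {μ ν ρ : Fin 6} (hμν : μ ≠ ν) (hμρ : μ ≠ ρ) (hνρ : ν ≠ ρ) :
    d.Γ μ * d.Γ ν * d.Γ ρ * (d.Γ μ * d.Γ ν * d.Γ ρ) =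
      (-((ηd μ : ℂ) * ηd ν * ηd ρ)) • (1 : Matrix (Fin 8) (Fin 8) ℂ) := by
  calc _ = d.Γ μ * d.Γ ν * (d.Γ ρ * d.Γ μ) * d.Γ ν * d.Γ ρ := by simp only [mul_assoc]
    _ = -(d.Γ μ * (d.Γ ν * d.Γ μ) * (d.Γ ρ * d.Γ ν) * d.Γ ρ) := by
      rw [d.Γ_anticomm hμρ.symm]; simp only [mul_assoc, neg_mul, mul_neg]
    _ = -((d.Γ μ * d.Γ μ) * (d.Γ ν * d.Γ ν) * (d.Γ ρ * d.Γ ρ)) := by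
      rw [d.Γ_anticomm hμν.symm, d.Γ_anticomm hνρ.symm]
      simp only [mul_assoc, neg_mul, mul_neg, neg_neg]
    _ = _ := by
      simp only [Γ_mul_self, mul_smul_comm, mul_one, smul_smul]
      module

/-- One summand of the duality identity between `Γ₇` and the Levi-Civita symbol. -/
lemma eps6_smul_Γ3_of_injective {μ ν ρ σ τ υ : Fin 6}
    (h : Function.Injective ![μ, ν, ρ, σ, τ, υ]) :
    ((eps6 μ ν ρ σ τ υ : ℂ) * (ηd μ * ηd ν * ηd ρ)) • d.Γ3 μ ν ρ = d.Γ7 * d.Γ3 σ τ υ := by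
  obtain ⟨π, hπ⟩ : ∃ π : Equiv.Perm (Fin 6), ⇑π = ![μ, ν, ρ, σ, τ, υ] :=
    ⟨Equiv.ofBijective _ (Finite.injective_iff_bijective.mp h), rfl⟩
  have hne := (injective_six_iff μ ν ρ σ τ υ).mp h
  have hΓ := d.prod_Γ_perm π
  have hε := eps6_perm π
  have hη := prod_ηd_perm π
  simp only [hπ] at hΓ hε hη
  change d.Γ μ * d.Γ ν * d.Γ ρ * d.Γ σ * d.Γ τ * d.Γ υ = _ at hΓ
  change eps6 μ ν ρ σ τ υ = _ at hε
  change (ηd μ : ℂ) * ηd ν * ηd ρ * ηd σ * ηd τ * ηd υ = -1 at hη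
  have hεε : ((Equiv.Perm.sign π : ℤ) : ℂ) * ((Equiv.Perm.sign π : ℤ) : ℂ) = 1 := by
    rcases Int.units_eq_one_or (Equiv.Perm.sign π) with hs | hs <;> simp [hs]
  obtain ⟨hμ, hν, hρ, hστ, hσυ, hτυ⟩ := hne
  have hmul := congrArg (· * (d.Γ σ * d.Γ τ * d.Γ υ)) hΓ
  have hassoc : d.Γ μ * d.Γ ν * d.Γ ρ * d.Γ σ * d.Γ τ * d.Γ υ =
      d.Γ μ * d.Γ ν * d.Γ ρ * (d.Γ σ * d.Γ τ * d.Γ υ) := by simp only [mul_assoc]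
  simp only [hassoc] at hmul
  rw [mul_assoc, d.prod_three_sq hστ hσυ hτυ, mul_smul_comm, mul_one, smul_mul_assoc] at hmul
  rw [d.Γ3_of_ne hστ hσυ hτυ, d.Γ3_of_ne (by tauto) (by tauto) (by tauto), hε]
  have hη' : (ηd μ : ℂ) * ηd ν * ηd ρ = -(ηd σ * ηd τ * ηd υ) := by
    linear_combination (ηd σ * ηd τ * ηd υ : ℂ) * hη
      - (ηd μ * ηd ν * ηd ρ : ℂ) * ((ηd τ * ηd τ * ηd υ * ηd υ : ℂ) * ηd_mul_self σ
        + (ηd υ * ηd υ : ℂ) * ηd_mul_self τ + ηd_mul_self υ)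
  rw [hη']
  push_cast
  rw [mul_smul, hmul, smul_smul, hεε, one_smul]

open Classical in
/-- The duality identity relating `Γ₇`, the antisymmetrised triple products and the
Levi-Civita symbol. -/
lemma sum_eps6_smul_Γ3 (σ τ υ : Fin 6) :
    ∑ μ, ∑ ν, ∑ ρ, ((eps6 μ ν ρ σ τ υ : ℂ) * (ηd μ * ηd ν * ηd ρ)) • d.Γ3 μ ν ρ =
      (6 : ℂ) • (d.Γ7 * d.Γ3 σ τ υ) := by
  have hterm (μ ν ρ : Fin 6) :
      ((eps6 μ ν ρ σ τ υ : ℂ) * (ηd μ * ηd ν * ηd ρ)) • d.Γ3 μ ν ρ =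
        (if Function.Injective ![μ, ν, ρ, σ, τ, υ] then (1 : ℂ) else 0) •
          (d.Γ7 * d.Γ3 σ τ υ) := by
    split_ifs with h
    · rw [d.eps6_smul_Γ3_of_injective h, one_smul]
    · simp [eps6_eq_zero h]
  simp only [hterm, ← Finset.sum_smul]
  by_cases h : σ ≠ τ ∧ σ ≠ υ ∧ τ ≠ υ
  · rw [sum_injective_six h.1 h.2.1 h.2.2]
  · rw [d.Γ3_eq_zero h, mul_zero, smul_zero, smul_zero]

end CliffordData

lemma cliffAct3_mul_Γ7 (d : CliffordData) (T : Fin 6 → Fin 6 → Fin 6 → ℂ) :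
    cliffAct3 d T * d.Γ7 = -(d.Γ7 * cliffAct3 d T) := by
  simp only [cliffAct3, smul_mul_assoc, mul_smul_comm, Finset.sum_mul, Finset.mul_sum,
    d.Γ3_mul_Γ7, smul_neg, Finset.sum_neg_distrib]

lemma sum_comm_three {ι M : Type*} [Fintype ι] [AddCommMonoid M] (f : ι → ι → ι → ι → ι → ι → M) :
    ∑ i, ∑ j, ∑ k, ∑ l, ∑ m, ∑ n, f i j k l m n = ∑ l, ∑ m, ∑ n, ∑ i, ∑ j, ∑ k, f i j k l m n := by
  have h := Finset.sum_comm (s := (Finset.univ : Finset (ι × ι × ι))) (t := Finset.univ)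
    (f := fun p q : ι × ι × ι => f p.1 p.2.1 p.2.2 q.1 q.2.1 q.2.2)
  simpa only [Fintype.sum_prod_type] using h

/-- The Hodge star on 3-forms is Clifford multiplication by `Γ₇` on the left. -/
lemma cliffAct3_hodge3C (d : CliffordData) (T : Fin 6 → Fin 6 → Fin 6 → ℂ) :
    cliffAct3 d (hodge3C T) = d.Γ7 * cliffAct3 d T := by
  have hterm (σ τ υ : Fin 6) : d.Γ7 * d.Γ3 σ τ υ = (1 / 6 : ℂ) • ∑ μ, ∑ ν, ∑ ρ,
      ((eps6 μ ν ρ σ τ υ : ℂ) * (ηd μ * ηd ν * ηd ρ)) • d.Γ3 μ ν ρ := by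
    rw [d.sum_eps6_smul_Γ3, smul_smul]; norm_num
  simp only [cliffAct3, hodge3C, mul_smul_comm, Finset.mul_sum, hterm, Finset.smul_sum,
    Finset.sum_mul, Finset.sum_smul, smul_smul]
  rw [sum_comm_three]
  refine Fintype.sum_congr _ _ fun σ => Fintype.sum_congr _ _ fun τ =>
    Fintype.sum_congr _ _ fun υ => Fintype.sum_congr _ _ fun μ =>
    Fintype.sum_congr _ _ fun ν => Fintype.sum_congr _ _ fun ρ => ?_
  congr 1
  ring

lemma cliffAct3_neg (d : CliffordData) (T : Fin 6 → Fin 6 → Fin 6 → ℂ) :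
    cliffAct3 d (fun μ ν ρ => -T μ ν ρ) = -cliffAct3 d T := by
  simp only [cliffAct3, neg_mul, neg_smul, Finset.sum_neg_distrib, smul_neg]

/-- If `Ξ₁, Ξ₂` are both self-dual 3-forms, or both
antiself-dual 3-forms, on `V`, then their Clifford product vanishes:
`Ξ₁ Ξ₂ = 0` in `Cℓ(V)` (acting on Σ). -/
theorem selfDual_clifford_product_vanishes (d : CliffordData)
    (T₁ T₂ : Fin 6 → Fin 6 → Fin 6 → ℂ) (h₁ : Alt3 T₁) (h₂ : Alt3 T₂)
    (h : (SelfDual3 T₁ ∧ SelfDual3 T₂) ∨ (AntiSelfDual3 T₁ ∧ AntiSelfDual3 T₂)) :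
    cliffAct3 d T₁ * cliffAct3 d T₂ = 0 := by
  have eq_zero_of_eq_neg {X : Matrix (Fin 8) (Fin 8) ℂ} (hX : X = -X) : X = 0 := by
    rw [eq_neg_iff_add_eq_zero, ← two_smul ℂ] at hX
    exact (smul_eq_zero.mp hX).resolve_left two_ne_zero
  have key : cliffAct3 d T₁ * d.Γ7 * cliffAct3 d T₂ =
      cliffAct3 d T₁ * (d.Γ7 * cliffAct3 d T₂) := mul_assoc _ _ _
  rw [cliffAct3_mul_Γ7, ← cliffAct3_hodge3C, ← cliffAct3_hodge3C] at key
  rcases h with ⟨hT₁, hT₂⟩ | ⟨hT₁, hT₂⟩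
  · have e₁ : hodge3C T₁ = T₁ := funext₃ hT₁
    have e₂ : hodge3C T₂ = T₂ := funext₃ hT₂
    rw [e₁, e₂, neg_mul] at key
    exact eq_zero_of_eq_neg key.symm
  · have e₁ : hodge3C T₁ = fun μ ν ρ => -T₁ μ ν ρ := funext₃ hT₁
    have e₂ : hodge3C T₂ = fun μ ν ρ => -T₂ μ ν ρ := funext₃ hT₂
    rw [e₁, e₂, cliffAct3_neg, cliffAct3_neg, neg_neg, mul_neg] at key
    exact eq_zero_of_eq_neg key
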